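/- Let r ≥ 1, m ≥ 1, N = r²·m and R = ℂ[z]/(z^N). Let V and W be free R-modules of rank r equipped with connections D^V and D^W of pole order m, and with filtrations V = V_0 ⊃ V_1 ⊃ ⋯ ⊃ V_{r−1} ⊃ V_r = 0 and W = W_0 ⊃ W_1 ⊃ ⋯ ⊃ W_{r−1} ⊃ W_r = 0 by submodules such that each V_i/V_{i+1} and each W_i/W_{i+1} is free of rank 1 over R and D^V(V_i) ⊆ V_i, D^W(W_i) ⊆ W_i for all i. Suppose each quotient V_i/V_{i+1} admits a basis e^V_i with D̄^V_i(e^V_i) = p_i·e^V_i, where D̄^V_i is the induced map and p_i = a^{(i)}_{−m} + a^{(i)}_{−m+1}z + ⋯ + a^{(i)}_{−1}z^{m−1} ∈ ℂ[z] (encoding the polar form ν^V_i = (a^{(i)}_{−m}z^{−m} + ⋯ + a^{(i)}_{−1}z^{−1})dz), and similarly each W_i/W_{i+1} admits a basis e^W_i with D̄^W_i(e^W_i) = q_i·e^W_i, with q_i encoding ν^W_i with coefficients b^{(i)}_{−m},…,b^{(i)}_{−1}. Assume 0 ≤ Re(a^{(i)}_{−1}) < 1 and 0 ≤ Re(b^{(i)}_{−1})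 < 1 for all i. If there exists an R-module isomorphism φ : V → W with D^W ∘ φ = φ ∘ D^V, then there is a permutation σ of {0,1,…,r−1} such that p_i = q_{σ(i)} (equivalently ν^V_i = ν^W_{σ(i)}) for all i = 0,…,r−1. -/

import Mathlib

noncomputable section

/-- The truncated polynomial ring `ℂ[z]/(z^N)`. -/
abbrev TruncPoly (N : ℕ) : Type :=
  Polynomial ℂ ⧸ Ideal.span {(Polynomial.X : Polynomial ℂ) ^ N}

/-- The quotient map `ℂ[z] → ℂ[z]/(z^N)`. -/
def tmk (N : ℕ) : Polynomial ℂ →+* TruncPoly N :=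
  Ideal.Quotient.mk _

/-- `D` is a connection of pole order `m` on the free module `Fin r → ℂ[z]/(z^N)`:
an additive map satisfying the Leibniz rule `D(a • v) = (z^m·(da/dz)) • v + a • D v`
(written via the surjection from `ℂ[z]`), in the trivialization by `dz/z^m`. -/
def IsTruncConnection (N m r : ℕ)
    (D : (Fin r → TruncPoly N) → (Fin r → TruncPoly N)) : Prop :=
  (∀ v w, D (v + w) = D v + D w) ∧
  ∀ (a : Polynomial ℂ) (v : Fin r → TruncPoly N),
    D (tmk N a • v) =
      tmk N (Polynomial.X ^ m * Polynomial.derivative a) • v + tmk N a • D v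

/-- A filtration `⊤ = l 0 ⊃ l 1 ⊃ ⋯ ⊃ l r = 0` by `D`-stable submodules whose
graded pieces `l i / l (i+1)` are free of rank one over `ℂ[z]/(z^N)` with a basis
`e` on which the induced connection acts as multiplication by the polynomial `p i`
(of degree `< m`, encoding the polar form `ν_i = p_i·dz/z^m`). -/
def IsEigenFiltration (N m r : ℕ)
    (D : (Fin r → TruncPoly N) → (Fin r → TruncPoly N))
    (p : ℕ → Polynomial ℂ)
    (l : ℕ → Submodule (TruncPoly N) (Fin r → TruncPoly N)) : Prop :=
  l 0 = ⊤ ∧ l r = ⊥ ∧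
  (∀ i < r, l (i + 1) ≤ l i) ∧
  (∀ i < r, ∀ v ∈ l i, D v ∈ l i) ∧
  (∀ i < r, ∃ e ∈ l i,
    l i = Submodule.span (TruncPoly N) {e} ⊔ l (i + 1) ∧
    (∀ a : TruncPoly N, a • e ∈ l (i + 1) → a = 0) ∧
    D e - tmk N (p i) • e ∈ l (i + 1))

open PowerSeries in
/-- Scalar key estimate, nonresonant case. -/
lemma scalar_key_ne (m K : ℕ) (hm : 1 ≤ m) (f g : PowerSeries ℂ) (s : ℕ)
    (hs : s < m) (hg0 : ∀ l < s, coeff l g = 0) (hgs : coeff s g ≠ 0)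
    (hres : s = m - 1 → ∀ k : ℕ, coeff s g + (k : ℂ) ≠ 0)
    (h : X ^ K ∣ X ^ m * derivative ℂ f + g * f) :
    ∀ k, k + s < K → coeff k f = 0 := by
  intro k
  induction k using Nat.strong_induction_on with
  | _ k ih =>
  intro hk
  have h1 := (X_pow_dvd_iff.1 h) (k + s) hk
  rw [map_add] at h1
  have h2 : coeff (k + s) (g * f) = coeff s g * coeff k f := by
    rw [coeff_mul]
    rw [Finset.sum_eq_single (s, k)]
    · rintro ⟨x, y⟩ hxy hne
      have hxy : x + y = k + s := Finset.HasAntidiagonal.mem_antidiagonal.1 hxy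
      by_cases hx : x < s
      · simp [hg0 x hx]
      · have : y < k := by
          rcases Nat.lt_or_ge s x with h' | h'
          · omega
          · exfalso
            apply hne
            have : x = s := by omega
            subst this
            have : y = k := by omega
            subst this
            rfl
        simp [ih y this (by omega)]
    · intro hn
      exfalso
      apply hn
      exact Finset.HasAntidiagonal.mem_antidiagonal.2 (add_comm s k)
  rw [h2, coeff_X_pow_mul'] at h1
  by_cases hsm : s = m - 1
  · have h3 : (if m ≤ k + s then coeff (k + s - m) (derivative ℂ f) else 0)
        = (k : ℂ) * coeff k f := by
      split_ifs with hc
      · have e1 : k + s - m + 1 = k := by omega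
        rw [coeff_derivative, e1]
        have : ((k + s - m : ℕ) : ℂ) + 1 = k := by exact_mod_cast e1
        rw [this, mul_comm]
      · have : k = 0 := by omega
        simp [this]
    rw [h3] at h1
    have h4 : (coeff s g + (k : ℂ)) * coeff k f = 0 := by linear_combination h1
    exact (mul_eq_zero.1 h4).resolve_left (hres hsm k)
  · have h3 : (if m ≤ k + s then coeff (k + s - m) (derivative ℂ f) else 0) = (0 : ℂ) := by
      split_ifs with hc
      · rw [coeff_derivative, ih (k + s - m + 1) (by omega) (by omega), zero_mul]
      · rfl
    rw [h3, zero_add] at h1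
    exact (mul_eq_zero.1 h1).resolve_left hgs

open PowerSeries in
/-- Scalar key estimate. -/
lemma scalar_key (m K : ℕ) (hm : 1 ≤ m) (hK : m ≤ K) (f : PowerSeries ℂ)
    (p q : Polynomial ℂ)
    (hpdeg : ∀ j, m ≤ j → p.coeff j = 0) (hqdeg : ∀ j, m ≤ j → q.coeff j = 0)
    (hpres : 0 ≤ (p.coeff (m - 1)).re ∧ (p.coeff (m - 1)).re < 1)
    (hqres : 0 ≤ (q.coeff (m - 1)).re ∧ (q.coeff (m - 1)).re < 1)
    (h : X ^ K ∣ X ^ m * derivative ℂ f + ((q : PowerSeries ℂ) - (p : PowerSeries ℂ)) * f) :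
    (constantCoeff f = 0 → X ^ (K - (m - 1)) ∣ f) ∧ (constantCoeff f ≠ 0 → p = q) := by
  by_cases hpq : p = q
  · subst hpq
    refine ⟨fun h0 => ?_, fun _ => rfl⟩
    rw [sub_self, zero_mul, add_zero] at h
    rw [X_pow_dvd_iff]
    intro k hk
    rcases k with _ | k
    · simpa using h0
    · have h1 := (X_pow_dvd_iff.1 h) (k + m) (by omega)
      rw [coeff_X_pow_mul, coeff_derivative] at h1
      refine (mul_eq_zero.1 h1).resolve_right ?_
      exact_mod_cast Nat.succ_ne_zero k
  · have hex : ∃ s, q.coeff s - p.coeff s ≠ 0 := by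
      by_contra hcon
      push Not at hcon
      exact hpq (Polynomial.ext fun n => (sub_eq_zero.1 (hcon n)).symm)
    classical
    let s := Nat.find hex
    have hs1 : q.coeff s - p.coeff s ≠ 0 := Nat.find_spec hex
    have hs2 : ∀ l < s, q.coeff l - p.coeff l = 0 := fun l hl => by
      simpa using Nat.find_min hex hl
    have hsm : s < m := by
      by_contra hc
      push Not at hc
      exact hs1 (by rw [hpdeg s hc, hqdeg s hc, sub_zero])
    have key := scalar_key_ne m K hm f ((q : PowerSeries ℂ) - (p : PowerSeries ℂ)) s hsm
      (fun l hl => by simpa using hs2 l hl) (by simpa using hs1) (by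
        intro hsm' k hk
        simp only [map_sub, Polynomial.coeff_coe] at hk
        rcases k with _ | k
        · apply hs1
          simpa using hk
        · rw [hsm'] at hk
          have := congrArg Complex.re hk
          simp at this
          have hk0 : (0 : ℝ) ≤ k := Nat.cast_nonneg k
          linarith [hpres.1, hpres.2, hqres.1, hqres.2]) h
    refine ⟨fun _ => ?_, fun h0 => ?_⟩
    · rw [X_pow_dvd_iff]
      intro k hk
      exact key k (by omega)
    · exfalso
      apply h0
      have := key 0 (by omega)
      simpa using this

open PowerSeries in
/-- Column estimate. -/
lemma column_key (m K n : ℕ) (hm : 1 ≤ m) (hK : (n + 1) * (n + 1) * m ≤ K)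
    (f : Fin (n + 1) → PowerSeries ℂ)
    (B : Fin (n + 1) → Fin (n + 1) → PowerSeries ℂ)
    (p : Polynomial ℂ) (q : Fin (n + 1) → Polynomial ℂ)
    (hpdeg : ∀ j, m ≤ j → p.coeff j = 0) (hqdeg : ∀ i, ∀ j, m ≤ j → (q i).coeff j = 0)
    (hpres : 0 ≤ (p.coeff (m - 1)).re ∧ (p.coeff (m - 1)).re < 1)
    (hqres : ∀ i, 0 ≤ ((q i).coeff (m - 1)).re ∧ ((q i).coeff (m - 1)).re < 1)
    (hB : ∀ a k, a < k → X ^ K ∣ B a k)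
    (hBd : ∀ a, X ^ K ∣ B a a - (q a : PowerSeries ℂ))
    (h : ∀ a, X ^ K ∣ X ^ m * derivative ℂ (f a) + ∑ k, B a k * f k - f a * (p : PowerSeries ℂ))
    (j : Fin (n + 1)) (hj : constantCoeff (f j) ≠ 0)
    (hjmin : ∀ a < j, constantCoeff (f a) = 0) :
    p = q j ∧ ∀ a < j, X ^ (n * n * m) ∣ f a := by
  have aux : ∀ a : Fin (n + 1), ∀ L, L ≤ K → (∀ k < a, X ^ L ∣ f k) →
      X ^ L ∣ X ^ m * derivative ℂ (f a) + ((q a : PowerSeries ℂ) - (p : PowerSeries ℂ)) * f a := by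
    intro a L hL hk
    have hLK : (X : PowerSeries ℂ) ^ L ∣ X ^ K := pow_dvd_pow _ hL
    have h1 : X ^ L ∣ ∑ k, B a k * f k - (q a : PowerSeries ℂ) * f a := by
      have : ∑ k, B a k * f k - (q a : PowerSeries ℂ) * f a
          = ∑ k, (B a k * f k - if k = a then (q a : PowerSeries ℂ) * f a else 0) := by
        rw [Finset.sum_sub_distrib]
        simp
      rw [this]
      apply Finset.dvd_sum
      intro k _
      rcases lt_trichotomy k a with hka | hka | hka
      · rw [if_neg hka.ne, sub_zero]
        exact (hk k hka).mul_left _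
      · subst hka
        rw [if_pos rfl, ← sub_mul]
        exact (hLK.trans (hBd k)).mul_right _
      · rw [if_neg hka.ne', sub_zero]
        exact (hLK.trans (hB a k hka)).mul_right _
    have h2 := dvd_sub (hLK.trans (h a)) h1
    convert h2 using 1
    ring
  have hbound : ∀ a : ℕ, a ≤ n → n * n * m + m ≤ K - a * (m - 1) := by
    intro a ha
    have h1 : a * (m - 1) ≤ n * m := Nat.mul_le_mul ha (by omega)
    have h2 : (n + 1) * (n + 1) * m = n * n * m + n * m + n * m + m := by ring
    omega
  have step : ∀ t : ℕ, ∀ a : Fin (n + 1), (a : ℕ) = t → a < j → X ^ (K - (t + 1) * (m - 1)) ∣ f a := by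
    intro t
    induction t using Nat.strong_induction_on with
    | _ t ih =>
    intro a hat haj
    have hlast : t ≤ n := by omega
    have := (scalar_key m (K - t * (m - 1)) hm (by have := hbound t hlast; omega) (f a) p (q a)
      hpdeg (hqdeg a) hpres (hqres a) (aux a _ (by omega) ?_)).1 (hjmin a haj)
    · convert this using 2
      rw [add_mul, one_mul]
      omega
    · intro k hk
      refine (pow_dvd_pow _ ?_).trans (ih k (by omega) k rfl (hk.trans haj))
      have : ((k : ℕ) + 1) * (m - 1) ≤ t * (m - 1) := Nat.mul_le_mul_right _ (by omega)
      omega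
  constructor
  · refine (scalar_key m (K - j * (m - 1)) hm (by have := hbound j (by omega); omega) (f j) p (q j)
      hpdeg (hqdeg j) hpres (hqres j) (aux j _ (by omega) ?_)).2 hj
    intro k hk
    refine (pow_dvd_pow _ ?_).trans (step k k rfl hk)
    have : ((k : ℕ) + 1) * (m - 1) ≤ j * (m - 1) := Nat.mul_le_mul_right _ (by omega)
    omega
  · intro a ha
    refine (pow_dvd_pow _ ?_).trans (step a a rfl ha)
    have := hbound (a + 1) (by omega)
    omega

open PowerSeries in
/-- Matrix version of the theorem, by induction on the rank. -/
lemma matrix_key (m : ℕ) (hm : 1 ≤ m) : ∀ (r K : ℕ) (_ : r * r * m ≤ K)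
    (F A B : Fin r → Fin r → PowerSeries ℂ) (p q : Fin r → Polynomial ℂ)
    (_ : ∀ i, ∀ j, m ≤ j → (p i).coeff j = 0) (_ : ∀ i, ∀ j, m ≤ j → (q i).coeff j = 0)
    (_ : ∀ i, 0 ≤ ((p i).coeff (m - 1)).re ∧ ((p i).coeff (m - 1)).re < 1)
    (_ : ∀ i, 0 ≤ ((q i).coeff (m - 1)).re ∧ ((q i).coeff (m - 1)).re < 1)
    (_ : ∀ a k, a < k → A a k = 0) (_ : ∀ a, A a a = (p a : PowerSeries ℂ))
    (_ : ∀ a k, a < k → X ^ K ∣ B a k) (_ : ∀ a, X ^ K ∣ B a a - (q a : PowerSeries ℂ))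
    (_ : ∀ a b, X ^ K ∣ X ^ m * derivative ℂ (F a b) + ∑ k, B a k * F k b - ∑ k, F a k * A k b)
    (_ : ∀ x : Fin r → ℂ, (∀ a, ∑ b, constantCoeff (F a b) * x b = 0) → x = 0),
    ∃ σ : Equiv.Perm (Fin r), ∀ i, p i = q (σ i) := by
  intro r
  induction r with
  | zero => intros; exact ⟨1, fun i => i.elim0⟩
  | succ n ih =>
  intro K hK F A B p q hpdeg hqdeg hpres hqres hA hAd hB hBd h hinj
  -- the pivot
  have hex : ∃ t : ℕ, ∃ a : Fin (n + 1), (a : ℕ) = t ∧ constantCoeff (F a (Fin.last n)) ≠ 0 := by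
    by_contra hcon
    push Not at hcon
    have := hinj (Pi.single (Fin.last n) 1) (fun a => by
      simp [Pi.single_apply, hcon a a rfl])
    have := congrFun this (Fin.last n)
    simp at this
  classical
  obtain ⟨j, hjt, hj⟩ := Nat.find_spec hex
  have hjmin : ∀ a < j, constantCoeff (F a (Fin.last n)) = 0 := by
    intro a ha
    by_contra hc
    exact Nat.find_min hex (m := a) (by omega) ⟨a, rfl, hc⟩
  have hAl : ∀ k : Fin n, A k.castSucc (Fin.last n) = 0 := fun k => hA _ _ (Fin.castSucc_lt_last k)
  obtain ⟨hpq, hdiv⟩ := column_key m K n hm hK (fun a => F a (Fin.last n)) B (p (Fin.last n)) q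
    (hpdeg _) hqdeg (hpres _) hqres hB hBd (fun a => by
      have := h a (Fin.last n)
      rw [Fin.sum_univ_castSucc (fun k => F a k * A k (Fin.last n))] at this
      simpa [hAl, hAd] using this) j hj hjmin
  set v : PowerSeries ℂ := (F j (Fin.last n))⁻¹ with hv
  have hvF : v * F j (Fin.last n) = 1 := PowerSeries.inv_mul_cancel _ hj
  set u : Fin (n + 1) → PowerSeries ℂ := fun a => F a (Fin.last n) * v with hu
  have huj : u j = 1 := by simp only [hu]; rw [mul_comm]; exact hvF
  have huF : ∀ a, F a (Fin.last n) = u a * F j (Fin.last n) := fun a => by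
    simp only [hu]; linear_combination (-F a (Fin.last n)) * hvF
  have hudiv : ∀ a < j, X ^ (n * n * m) ∣ u a := fun a ha => (hdiv a ha).mul_right _
  have hKK : n * n * m ≤ K := le_trans (Nat.mul_le_mul_right _ (Nat.mul_le_mul (by omega) (by omega))) hK
  have hKd : (X : PowerSeries ℂ) ^ (n * n * m) ∣ X ^ K := pow_dvd_pow _ hKK
  obtain ⟨σ, hσ⟩ := ih (n * n * m) le_rfl
    (fun a b => F (j.succAbove a) b.castSucc - u (j.succAbove a) * F j b.castSucc)
    (fun a b => A a.castSucc b.castSucc)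
    (fun a b => B (j.succAbove a) (j.succAbove b) - u (j.succAbove a) * B j (j.succAbove b))
    (fun i => p i.castSucc) (fun i => q (j.succAbove i))
    (fun i => hpdeg _) (fun i => hqdeg _) (fun i => hpres _) (fun i => hqres _)
    (fun a k hak => hA _ _ (by simpa using hak)) (fun a => hAd _)
    (by
      intro a k hak
      have hak' : j.succAbove a < j.succAbove k := Fin.succAbove_lt_succAbove_iff.2 hak
      refine dvd_sub (hKd.trans (hB _ _ hak')) ?_
      by_cases hkj : j < j.succAbove k
      · exact (hKd.trans (hB _ _ hkj)).mul_left _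
      · refine (hudiv _ ?_).mul_right _
        exact lt_of_lt_of_le hak' (not_lt.1 hkj))
    (by
      intro a
      have : B (j.succAbove a) (j.succAbove a) - u (j.succAbove a) * B j (j.succAbove a)
        - (q (j.succAbove a) : PowerSeries ℂ) = (B (j.succAbove a) (j.succAbove a)
        - (q (j.succAbove a) : PowerSeries ℂ)) - u (j.succAbove a) * B j (j.succAbove a) := by ring
      rw [this]
      refine dvd_sub (hKd.trans (hBd _)) ?_
      rcases lt_or_gt_of_ne (Fin.succAbove_ne j a) with h1 | h1
      · exact (hudiv _ h1).mul_right _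
      · exact (hKd.trans (hB _ _ h1)).mul_left _)
    (by
      intro a b
      set a' := j.succAbove a
      have E1 := h a' b.castSucc
      have E2 := h j b.castSucc
      have E3 := h a' (Fin.last n)
      have E4 := h j (Fin.last n)
      have hd : derivative ℂ (F a' (Fin.last n)) =
          u a' * derivative ℂ (F j (Fin.last n)) + F j (Fin.last n) * derivative ℂ (u a') := by
        rw [huF a', Derivation.leibniz]
        simp only [smul_eq_mul]
      have key := dvd_sub (dvd_sub E1 (E2.mul_left (u a')))
        ((dvd_sub E3 (E4.mul_left (u a'))).mul_left (v * F j b.castSucc))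
      refine hKd.trans ?_
      convert key using 1
      rw [hd, map_sub, Derivation.leibniz]
      simp only [smul_eq_mul]
      rw [Fin.sum_univ_castSucc (fun k => F a' k * A k (Fin.last n)),
        Fin.sum_univ_castSucc (fun k => F j k * A k (Fin.last n)),
        Fin.sum_univ_castSucc (fun k => F a' k * A k b.castSucc),
        Fin.sum_univ_castSucc (fun k => F j k * A k b.castSucc)]
      simp only [hAl, mul_zero, Finset.sum_const_zero, zero_add]
      have s1 : ∑ k, B a' k * F k (Fin.last n) = (∑ k, B a' k * u k) * F j (Fin.last n) := by
        rw [Finset.sum_mul]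
        exact Finset.sum_congr rfl fun k _ => by rw [huF k]; ring
      have s2 : ∑ k, B j k * F k (Fin.last n) = (∑ k, B j k * u k) * F j (Fin.last n) := by
        rw [Finset.sum_mul]
        exact Finset.sum_congr rfl fun k _ => by rw [huF k]; ring
      rw [s1, s2]
      have s3 : ∑ k : Fin n, (B a' (j.succAbove k) - u a' * B j (j.succAbove k)) *
          (F (j.succAbove k) b.castSucc - u (j.succAbove k) * F j b.castSucc)
          = (∑ k, B a' k * F k b.castSucc) - u a' * (∑ k, B j k * F k b.castSucc)
            - ((∑ k, B a' k * u k) - u a' * ∑ k, B j k * u k) * F j b.castSucc := by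
        have : ∀ k, (B a' k - u a' * B j k) * (F k b.castSucc - u k * F j b.castSucc)
          = B a' k * F k b.castSucc - u a' * (B j k * F k b.castSucc)
            - (B a' k * u k - u a' * (B j k * u k)) * F j b.castSucc := fun k => by ring
        have s4 := Fin.sum_univ_succAbove
          (fun k => (B a' k - u a' * B j k) * (F k b.castSucc - u k * F j b.castSucc)) j
        rw [huj, one_mul, sub_self, mul_zero, zero_add] at s4
        rw [← s4, Finset.sum_congr rfl fun k _ => this k]
        rw [Finset.sum_sub_distrib, Finset.sum_sub_distrib, ← Finset.sum_mul,
          Finset.sum_sub_distrib, ← Finset.mul_sum, ← Finset.mul_sum]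
      rw [s3]
      have s5 : ∑ k : Fin n, (F a' k.castSucc - u a' * F j k.castSucc) * A k.castSucc b.castSucc
          = ∑ k : Fin n, F a' k.castSucc * A k.castSucc b.castSucc
            - u a' * ∑ k : Fin n, F j k.castSucc * A k.castSucc b.castSucc := by
        rw [Finset.mul_sum, ← Finset.sum_sub_distrib]
        exact Finset.sum_congr rfl fun k _ => by ring
      rw [s5, huF a']
      linear_combination (X ^ m * F j b.castSucc * derivative ℂ (u a')
        + F j b.castSucc * ((∑ k, B a' k * u k) - u a' * ∑ k, B j k * u k)) * hvF)
    (by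
      intro x hx
      set c := constantCoeff (R := ℂ)
      let t : ℂ := - c v * ∑ b : Fin n, c (F j b.castSucc) * x b
      have hc : c v * c (F j (Fin.last n)) = 1 := by rw [← map_mul, hvF, map_one]
      have hrow : ∑ b : Fin n, c (F j b.castSucc) * x b + c (F j (Fin.last n)) * t = 0 := by
        simp only [t]
        linear_combination (- ∑ b : Fin n, c (F j b.castSucc) * x b) * hc
      have h0 := hinj (Fin.snoc (α := fun _ => ℂ) x t) (by
        intro a
        rw [Fin.sum_univ_castSucc]
        simp only [Fin.snoc_castSucc, Fin.snoc_last]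
        rcases Fin.eq_self_or_eq_succAbove j a with ha | ⟨a, rfl⟩
        · rw [ha]; exact hrow
        · have := hx a
          simp only [map_sub, map_mul, sub_mul, Finset.sum_sub_distrib, mul_assoc,
            ← Finset.mul_sum] at this
          rw [huF (j.succAbove a), map_mul]
          linear_combination this + c (u (j.succAbove a)) * hrow)
      funext b
      have := congrFun h0 b.castSucc
      simpa using this)
  refine ⟨(finSuccEquivLast).trans ((Equiv.optionCongr σ).trans (finSuccEquiv' j).symm), ?_⟩
  intro i
  refine Fin.lastCases ?_ (fun i => ?_) i
  · simpa using hpq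
  · simpa using hσ i

lemma tmk_eq_zero (N : ℕ) (a : Polynomial ℂ) : tmk N a = 0 ↔ Polynomial.X ^ N ∣ a := by
  unfold tmk
  rw [Ideal.Quotient.eq_zero_iff_mem, Ideal.mem_span_singleton]

lemma tmk_surj (N : ℕ) (a : TruncPoly N) : ∃ b, tmk N b = a :=
  Ideal.Quotient.mk_surjective a

lemma tzero_smul (N r : ℕ) (v : Fin r → TruncPoly N) : (0 : TruncPoly N) • v = 0 :=
  zero_smul (TruncPoly N) v

/-- Adapted bases. -/
lemma adapted_basis (N m r : ℕ) (D : (Fin r → TruncPoly N) → (Fin r → TruncPoly N))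
    (p : ℕ → Polynomial ℂ) (l : ℕ → Submodule (TruncPoly N) (Fin r → TruncPoly N))
    (hl : IsEigenFiltration N m r D p l) :
    ∃ (e : Fin r → (Fin r → TruncPoly N)) (A : Fin r → Fin r → Polynomial ℂ),
      (∀ v, ∃ c : Fin r → Polynomial ℂ, v = ∑ k, tmk N (c k) • e k) ∧
      (∀ c : Fin r → Polynomial ℂ, ∑ k, tmk N (c k) • e k = 0 → ∀ k, tmk N (c k) = 0) ∧
      (∀ b, D (e b) = ∑ k, tmk N (A k b) • e k) ∧
      (∀ a k, a < k → A a k = 0) ∧ (∀ a, A a a = p a) := by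
  obtain ⟨h0, hr, hanti, hD, he⟩ := hl
  choose! e hel hspan hfree heig using he
  have hspanall : ∀ d i, i + d = r → ∀ v ∈ l i, ∃ c : Fin r → TruncPoly N,
      (∀ k : Fin r, (k : ℕ) < i → c k = 0) ∧ v = ∑ k : Fin r, c k • e k := by
    intro d
    induction d with
    | zero =>
      intro i hi v hv
      have : i = r := by omega
      subst this
      rw [hr, Submodule.mem_bot] at hv
      exact ⟨0, fun _ _ => rfl, by simp [hv, tzero_smul]⟩
    | succ d ih =>
      intro i hi v hv
      have hir : i < r := by omega
      rw [hspan i hir, Submodule.mem_sup] at hv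
      obtain ⟨y, hy, z, hz, rfl⟩ := hv
      obtain ⟨a, rfl⟩ := Submodule.mem_span_singleton.1 hy
      obtain ⟨c, hc, rfl⟩ := ih (i + 1) (by omega) z hz
      refine ⟨c + Pi.single ⟨i, hir⟩ a, ?_, ?_⟩
      · intro k hk
        have hne : k ≠ ⟨i, hir⟩ := by
          intro h
          rw [h] at hk
          exact lt_irrefl _ hk
        simp [hc k (by omega), hne]
      · simp only [Pi.add_apply, add_smul, Finset.sum_add_distrib]
        rw [add_comm]
        congr 1
        rw [Finset.sum_eq_single ⟨i, hir⟩]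
        · simp
        · intro b _ hb
          simp [hb, tzero_smul]
        · simp
  have hmono : ∀ i k, i ≤ k → k ≤ r → l k ≤ l i := by
    intro i k hik
    induction k, hik using Nat.le_induction with
    | base => intro _; exact le_rfl
    | succ k hk ih => intro hkr; exact (hanti k (by omega)).trans (ih (by omega))
  have hind : ∀ c : Fin r → TruncPoly N, ∑ k : Fin r, c k • e k = 0 → ∀ k, c k = 0 := by
    intro c hc
    have : ∀ t : ℕ, ∀ k : Fin r, (k : ℕ) = t → c k = 0 := by
      intro t
      induction t using Nat.strong_induction_on with
      | _ t ih =>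
      intro k hk
      apply hfree k k.2
      have h1 := Finset.add_sum_erase Finset.univ (fun k : Fin r => c k • e k) (Finset.mem_univ k)
      rw [hc] at h1
      rw [eq_neg_of_add_eq_zero_left h1]
      refine Submodule.neg_mem _ (Submodule.sum_mem _ ?_)
      intro b hb
      have hbk : b ≠ k := Finset.ne_of_mem_erase hb
      rcases lt_or_gt_of_ne hbk with h2 | h2
      · rw [ih b (by omega) b rfl, tzero_smul]
        exact Submodule.zero_mem _
      · exact Submodule.smul_mem _ _ (hmono (k + 1) b (by omega) (by omega) (hel b b.2))
    exact fun k => this k k rfl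
  have hex : ∀ b : Fin r, ∃ c : Fin r → TruncPoly N,
      (∀ k : Fin r, (k : ℕ) < b + 1 → c k = 0) ∧
      D (e b) - tmk N (p b) • e b = ∑ k : Fin r, c k • e k := fun b =>
    hspanall (r - (b + 1)) (b + 1) (by omega) _ (heig b b.2)
  choose c hc1 hc2 using hex
  choose lift hlift using tmk_surj N
  refine ⟨fun k => e k, fun k b => if k = b then p b else if k < b then 0 else lift (c b k),
    ?_, ?_, ?_, ?_, ?_⟩
  · intro v
    obtain ⟨c, -, hc⟩ := hspanall r 0 (by omega) v (by rw [h0]; trivial)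
    exact ⟨fun k => lift (c k), by simpa only [hlift] using hc⟩
  · intro c hc
    exact hind _ hc
  · intro b
    have : ∀ k : Fin r, tmk N (if k = b then p b else if k < b then 0 else lift (c b k)) • e k
        = c b k • e k + if k = b then tmk N (p b) • e b else 0 := by
      intro k
      rcases lt_trichotomy k b with hk | hk | hk
      · rw [if_neg hk.ne, if_neg hk.ne, if_pos hk, hc1 b k (by omega)]
        simp [tzero_smul]
      · subst hk
        rw [if_pos rfl, if_pos rfl, hc1 k k (by omega)]
        simp [tzero_smul]
      · rw [if_neg hk.ne', if_neg hk.ne', if_neg (not_lt.2 hk.le), hlift]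
        simp
    rw [Finset.sum_congr rfl fun k _ => this k, Finset.sum_add_distrib, ← hc2 b]
    simp
  · intro a k hak
    simp [hak, hak.ne]
  · intro a
    simp

theorem main_aux (N r m : ℕ) (hN : N = r * r * m) (hr : 1 ≤ r) (hm : 1 ≤ m)
    (DV DW : (Fin r → TruncPoly N) → (Fin r → TruncPoly N))
    (hDV : IsTruncConnection N m r DV)
    (hDW : IsTruncConnection N m r DW)
    (p q : ℕ → Polynomial ℂ)
    (hpdeg : ∀ i < r, ∀ j, m ≤ j → (p i).coeff j = 0)
    (hqdeg : ∀ i < r, ∀ j, m ≤ j → (q i).coeff j = 0)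
    (hpres : ∀ i < r, 0 ≤ ((p i).coeff (m - 1)).re ∧ ((p i).coeff (m - 1)).re < 1)
    (hqres : ∀ i < r, 0 ≤ ((q i).coeff (m - 1)).re ∧ ((q i).coeff (m - 1)).re < 1)
    (lV lW : ℕ → Submodule (TruncPoly N) (Fin r → TruncPoly N))
    (hlV : IsEigenFiltration N m r DV p lV)
    (hlW : IsEigenFiltration N m r DW q lW)
    (φ : (Fin r → TruncPoly N) ≃ₗ[TruncPoly N]
        (Fin r → TruncPoly N))
    (hφ : ∀ v, φ (DV v) = DW (φ v)) :
    ∃ σ : Equiv.Perm (Fin r), ∀ i : Fin r, p (i : ℕ) = q ((σ i : Fin r) : ℕ) := by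
  have hNpos : 1 ≤ N := by
    rw [hN]
    exact Nat.mul_pos (Nat.mul_pos hr hr) hm
  obtain ⟨e, A, hes, hei, heD, hA0, hAd⟩ := adapted_basis N m r DV p lV hlV
  obtain ⟨f, B, hfs, hfi, hfD, hB0, hBd⟩ := adapted_basis N m r DW q lW hlW
  choose G hG using fun b => hfs (φ (e b))
  have hDsum : ∀ (s : Finset (Fin r)) (w : Fin r → (Fin r → TruncPoly N)),
      DW (∑ k ∈ s, w k) = ∑ k ∈ s, DW (w k) := fun s w =>
    map_sum (AddMonoidHom.mk' DW hDW.1) w s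
  -- the compatibility equation
  have heq : ∀ a b, Polynomial.X ^ N ∣ Polynomial.X ^ m * Polynomial.derivative (G b a)
      + ∑ k, B a k * G b k - ∑ k, G k a * A k b := by
    intro a b
    rw [← tmk_eq_zero]
    revert a
    apply hfi
    have h1 := hφ (e b)
    rw [heD, map_sum, hG b, hDsum] at h1
    simp only [map_smul, hG, hDW.2, hfD] at h1
    simp only [map_sub, map_add, map_sum, sub_smul, add_smul, Finset.sum_sub_distrib,
      Finset.sum_add_distrib]
    rw [sub_eq_zero]
    rw [Finset.sum_add_distrib] at h1
    simp only [Finset.smul_sum, smul_smul] at h1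
    simp only [Finset.sum_smul]
    rw [Finset.sum_comm (f := fun a k => tmk N (B a k * G b k) • f a),
      Finset.sum_comm (f := fun a k => tmk N (G k a * A k b) • f a)]
    simp only [map_mul] at h1 ⊢
    refine Eq.trans ?_ (h1.symm.trans ?_)
    · congr 1
      refine Finset.sum_congr rfl fun k _ => Finset.sum_congr rfl fun a _ => ?_
      rw [mul_comm]
    · refine Finset.sum_congr rfl fun k _ => Finset.sum_congr rfl fun a _ => ?_
      rw [mul_comm]
  have hcoe : ∀ g : Polynomial ℂ, Polynomial.X ^ N ∣ g →
      (PowerSeries.X : PowerSeries ℂ) ^ N ∣ (g : PowerSeries ℂ) := by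
    rintro g ⟨g', rfl⟩
    exact ⟨g', by simp⟩
  have hsumcoe : ∀ g : Fin r → Polynomial ℂ,
      ((∑ k, g k : Polynomial ℂ) : PowerSeries ℂ) = ∑ k, (g k : PowerSeries ℂ) := fun g =>
    map_sum (Polynomial.coeToPowerSeries.ringHom (R := ℂ)) g Finset.univ
  refine matrix_key m hm r N hN.ge (fun a b => (G b a : PowerSeries ℂ))
    (fun a b => (A a b : PowerSeries ℂ)) (fun a b => (B a b : PowerSeries ℂ))
    (fun i => p i) (fun i => q i) (fun i => hpdeg i i.2) (fun i => hqdeg i i.2)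
    (fun i => hpres i i.2) (fun i => hqres i i.2) ?_ ?_ ?_ ?_ ?_ ?_
  · intro a k hak
    simp [hA0 a k hak]
  · intro a
    simp [hAd a]
  · intro a k hak
    simp [hB0 a k hak]
  · intro a
    simp [hBd a]
  · intro a b
    have := hcoe _ (heq a b)
    simpa [hsumcoe, PowerSeries.derivative_coe] using this
  · intro x hx
    have hz : φ (tmk N (Polynomial.X ^ (N - 1)) • ∑ b, tmk N (Polynomial.C (x b)) • e b) = 0 := by
      rw [map_smul, map_sum]
      simp only [map_smul, hG, Finset.smul_sum, smul_smul]
      rw [Finset.sum_comm]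
      refine Finset.sum_eq_zero fun a _ => ?_
      rw [← Finset.sum_smul]
      have : ∑ b, tmk N (Polynomial.X ^ (N - 1)) * (tmk N (Polynomial.C (x b)) * tmk N (G b a))
          = 0 := by
        simp only [← map_mul, ← map_sum]
        rw [tmk_eq_zero, ← Finset.mul_sum]
        have h1 : Polynomial.X ∣ ∑ b, Polynomial.C (x b) * G b a := by
          rw [Polynomial.X_dvd_iff, Polynomial.finsetSum_coeff]
          have := hx a
          simpa [mul_comm] using this
        have h2 := mul_dvd_mul_left (Polynomial.X ^ (N - 1)) h1
        rwa [← pow_succ, Nat.sub_add_cancel hNpos] at h2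
      rw [this, tzero_smul]
    have hz' := (LinearEquiv.map_eq_zero_iff φ).1 hz
    simp only [Finset.smul_sum, smul_smul, ← map_mul] at hz'
    funext b
    have h1 := hei _ hz' b
    rw [tmk_eq_zero, Polynomial.X_pow_dvd_iff] at h1
    have := h1 (N - 1) (by omega)
    simpa [Polynomial.coeff_X_pow_mul'] using this

/-- **Reduction to order `r²m` determines the exponents.** Let `R = ℂ[z]/(z^{r²m})`
and let `V, W` be free `R`-modules of rank `r` with connections of pole order `m`
and filtrations with free rank-one graded pieces on which the connections act by
the polar forms encoded by `p i`, resp. `q i`, whose residues have real part in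
`[0, 1)`. If there is an `R`-module isomorphism `φ : V → W` compatible with the
connections, then the exponents agree up to a permutation `σ`: `p i = q (σ i)`. -/
theorem depth_r_sq_m_determines_exponents (r m : ℕ) (hr : 1 ≤ r) (hm : 1 ≤ m)
    (DV DW : (Fin r → TruncPoly (r * r * m)) → (Fin r → TruncPoly (r * r * m)))
    (hDV : IsTruncConnection (r * r * m) m r DV)
    (hDW : IsTruncConnection (r * r * m) m r DW)
    (p q : ℕ → Polynomial ℂ)
    (hpdeg : ∀ i < r, ∀ j, m ≤ j → (p i).coeff j = 0)
    (hqdeg : ∀ i < r, ∀ j, m ≤ j → (q i).coeff j = 0)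
    (hpres : ∀ i < r, 0 ≤ ((p i).coeff (m - 1)).re ∧ ((p i).coeff (m - 1)).re < 1)
    (hqres : ∀ i < r, 0 ≤ ((q i).coeff (m - 1)).re ∧ ((q i).coeff (m - 1)).re < 1)
    (lV lW : ℕ → Submodule (TruncPoly (r * r * m)) (Fin r → TruncPoly (r * r * m)))
    (hlV : IsEigenFiltration (r * r * m) m r DV p lV)
    (hlW : IsEigenFiltration (r * r * m) m r DW q lW)
    (φ : (Fin r → TruncPoly (r * r * m)) ≃ₗ[TruncPoly (r * r * m)]
        (Fin r → TruncPoly (r * r * m)))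
    (hφ : ∀ v, φ (DV v) = DW (φ v)) :
    ∃ σ : Equiv.Perm (Fin r), ∀ i : Fin r, p (i : ℕ) = q ((σ i : Fin r) : ℕ) := by
  exact main_aux _ r m rfl hr hm DV DW hDV hDW p q hpdeg hqdeg hpres hqres lV lW hlV hlW φ hφ
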